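/- Let P ∈ P_1 have distribution function F, and let F* be a distribution function with density f* = e^{φ*} ∈ F_1. For φ ∈ Φ, let S(φ) := {x ∈ dom(φ) : φ(x) > (φ(x+δ) + φ(x−δ))/2 for all δ > 0}. Then f* = ψ*(P) if and only if ∫_{−∞}^x (F*(t) − F(t)) dt ≤ 0 for all x ∈ ℝ, with equality both for every x ∈ S(φ*) and in the limit x → ∞ (i.e., ∫_{−∞}^{∞} (F*(t) − F(t)) dt = 0). -/

import Mathlib

open MeasureTheory Filter Set
open scoped ENNReal Topology

noncomputable section

/-- `ℝ^d` with its Euclidean norm and Lebesgue measure. -/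
abbrev Rd (d : ℕ) : Type := EuclideanSpace ℝ (Fin d)

/-- A nonnegative function is log-concave (`log f` is concave, with `log 0 := -∞`),
expressed multiplicatively via `f x ^ (1-t) * f y ^ t ≤ f ((1-t) • x + t • y)`. -/
def IsLogConcaveFn {E : Type*} [AddCommGroup E] [Module ℝ E] (f : E → ℝ) : Prop :=
  (∀ x, 0 ≤ f x) ∧
  ∀ x y : E, ∀ t : ℝ, t ∈ Set.Icc (0:ℝ) 1 →
    f x ^ (1 - t) * f y ^ t ≤ f ((1 - t) • x + t • y)

/-- A probability density with respect to the (Lebesgue) measure of a `MeasureSpace`. -/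
def IsDensity {E : Type*} [MeasureSpace E] (f : E → ℝ) : Prop :=
  (∀ x, 0 ≤ f x) ∧ Measurable f ∧ ∫⁻ x, ENNReal.ofReal (f x) = 1

/-- Membership in the class `F_d`: an upper semi-continuous log-concave probability
density. -/
def IsLCDensity {E : Type*} [MeasureSpace E] [TopologicalSpace E] [AddCommGroup E]
    [Module ℝ E] (f : E → ℝ) : Prop :=
  IsDensity f ∧ UpperSemicontinuous f ∧ IsLogConcaveFn f

/-- Membership in the class `P_d`: probability measures with finite first moment that are
not concentrated on any affine hyperplane `{x | l x = c}` (`l` a nonzero linear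
functional). -/
def MemP {E : Type*} [NormedAddCommGroup E] [NormedSpace ℝ E] [MeasureSpace E]
    (P : Measure E) : Prop :=
  IsProbabilityMeasure P ∧ Integrable (fun x => ‖x‖) P ∧
  ∀ (l : E →ₗ[ℝ] ℝ) (c : ℝ), l ≠ 0 → P {x | l x = c} < 1

/-- The log-concave projection predicate: `fs ∈ F_d` maximises `∫ log f dP` over `F_d`
(candidates whose objective is `-∞`, i.e. that vanish on a set of positive `P`-measure or
have non-integrable logarithm, are trivially dominated). -/
def IsLCProj {E : Type*} [NormedAddCommGroup E] [NormedSpace ℝ E] [MeasureSpace E]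
    (P : Measure E) (fs : E → ℝ) : Prop :=
  IsLCDensity fs ∧ (∀ᵐ x ∂P, 0 < fs x) ∧ Integrable (fun x => Real.log (fs x)) P ∧
  ∀ g : E → ℝ, IsLCDensity g → (∀ᵐ x ∂P, 0 < g x) →
    Integrable (fun x => Real.log (g x)) P →
    ∫ x, Real.log (g x) ∂P ≤ ∫ x, Real.log (fs x) ∂P

/-- `log y` with values in `[-∞, ∞)`, with the convention `log 0 := -∞`. -/
def elog (y : ℝ) : EReal := if y ≤ 0 then ⊥ else ((Real.log y : ℝ) : EReal)

/-- Positive part of an extended real number, as an `ℝ≥0∞`. -/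
def epos (a : EReal) : ℝ≥0∞ := if a = ⊤ then ⊤ else ENNReal.ofReal a.toReal

/-- `e^a` for an extended real `a`, valued in `[0,∞]`. -/
def expE (a : EReal) : ℝ≥0∞ :=
  if a = ⊥ then 0 else if a = ⊤ then ⊤ else ENNReal.ofReal (Real.exp a.toReal)

/-- Integral of an `EReal`-valued function: positive part minus negative part. -/
def erealIntegral {α : Type*} [MeasurableSpace α] (P : Measure α) (φ : α → EReal) : EReal :=
  ((∫⁻ x, epos (φ x) ∂P : ℝ≥0∞) : EReal) - ((∫⁻ x, epos (-(φ x)) ∂P : ℝ≥0∞) : EReal)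

/-- The class `Φ`: upper semi-continuous, concave functions `φ : E → [-∞, ∞)` with
`φ(x) → -∞` as `‖x‖ → ∞`. -/
def MemPhi {E : Type*} [NormedAddCommGroup E] [NormedSpace ℝ E] (φ : E → EReal) : Prop :=
  (∀ x, φ x ≠ ⊤) ∧ UpperSemicontinuous φ ∧
  (∀ x y : E, ∀ t : ℝ, t ∈ Set.Icc (0:ℝ) 1 →
    (((1 - t : ℝ)) : EReal) * φ x + ((t : ℝ) : EReal) * φ y ≤ φ ((1 - t) • x + t • y)) ∧
  Tendsto φ (Filter.comap (fun x => ‖x‖) Filter.atTop) (nhds ⊥)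

/-- The functional `L(φ, P) = ∫ φ dP - ∫ e^φ dx`. -/
def Lfun {E : Type*} [NormedAddCommGroup E] [NormedSpace ℝ E] [MeasureSpace E]
    (φ : E → EReal) (P : Measure E) : EReal :=
  erealIntegral P φ - ((∫⁻ x, expE (φ x) : ℝ≥0∞) : EReal)

/-- `L*(P) = sup_{φ ∈ Φ} L(φ, P)`. -/
def Lstar {E : Type*} [NormedAddCommGroup E] [NormedSpace ℝ E] [MeasureSpace E]
    (P : Measure E) : EReal :=
  ⨆ (φ : E → EReal) (_ : MemPhi φ), Lfun φ P

/-- Action of a matrix on a Euclidean vector. -/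
def mulVE {m d : ℕ} (A : Matrix (Fin m) (Fin d) ℝ) (x : Rd d) : Rd m :=
  (WithLp.equiv 2 (Fin m → ℝ)).symm (A.mulVec ((WithLp.equiv 2 (Fin d → ℝ)) x))

/-- A concave function on the line is the integral of an antitone selection of its
supergradients. -/
theorem exists_supergradient {L : ℝ → ℝ} (hL : ConcaveOn ℝ univ L) :
    ∃ w : ℝ → ℝ, Antitone w ∧ (∀ s u, L u ≤ L s + w s * (u - s)) ∧
      ∀ a b, ∫ t in a..b, w t = L b - L a := by
  have hC : ConvexOn ℝ univ (-L) := hL.neg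
  have hder : ∀ x, HasDerivWithinAt (-L) (derivWithin (-L) (Ioi x) x) (Ioi x) x := fun x =>
    hC.hasDerivWithinAt_rightDeriv_of_mem_interior (by simp)
  have hmono : Monotone fun x => derivWithin (-L) (Ioi x) x := by
    have := hC.monotoneOn_rightDeriv
    simpa [monotoneOn_univ] using this
  have hanti : Antitone fun x => -derivWithin (-L) (Ioi x) x := hmono.neg
  refine ⟨fun x => -derivWithin (-L) (Ioi x) x, hanti, ?_, ?_⟩
  · intro s u
    rcases lt_trichotomy s u with h | h | h
    · have := hC.rightDeriv_le_slope_of_mem_interior (x := s) (y := u) (by simp) (by simp) h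
      rw [slope_def_field, le_div_iff₀ (by linarith)] at this
      simp only [Pi.neg_apply] at this
      linarith
    · subst h; simp
    · have h1 := hC.slope_le_leftDeriv_of_mem_interior (x := u) (y := s) (by simp) (by simp) h
      have h2 := hC.leftDeriv_le_rightDeriv_of_mem_interior (x := s) (by simp)
      have := h1.trans h2
      rw [slope_def_field, div_le_iff₀ (by linarith)] at this
      simp only [Pi.neg_apply] at this
      linarith
  · have hcont : Continuous L := by
      have := hL.continuousOn isOpen_univ
      exact continuousOn_univ.mp this
    have key : ∀ a b, a ≤ b → ∫ t in a..b, -derivWithin (-L) (Ioi t) t = L b - L a := by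
      intro a b hab
      refine intervalIntegral.integral_eq_sub_of_hasDeriv_right_of_le hab hcont.continuousOn
        (fun x _ => ?_) ?_
      · simpa using (hder x).neg
      · exact hanti.intervalIntegrable
    intro a b
    rcases le_total a b with h | h
    · exact key a b h
    · rw [intervalIntegral.integral_symm, key b a h]; ring

/-- The kernel `1_{[0,s)} - 1_{[s,0)}` representing `∫ t in 0..s`. -/
def stepKernel (s t : ℝ) : ℝ :=
  (if 0 ≤ t then 1 else 0) - (if s ≤ t then 1 else 0)

theorem stepKernel_eq (s t : ℝ) :
    stepKernel s t = (Ico 0 s).indicator 1 t - (Ico s 0).indicator 1 t := by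
  unfold stepKernel
  simp only [indicator, mem_Ico, Pi.one_apply]
  split_ifs <;> simp_all <;> linarith

theorem measurable_stepKernel : Measurable (Function.uncurry stepKernel) := by
  unfold stepKernel Function.uncurry
  refine Measurable.sub ?_ ?_
  · exact Measurable.ite (measurableSet_le measurable_const measurable_snd) measurable_const
      measurable_const
  · exact Measurable.ite (measurableSet_le measurable_fst measurable_snd) measurable_const
      measurable_const

theorem integral_mul_stepKernel {w : ℝ → ℝ} (hw : ∀ a b, IntervalIntegrable w volume a b)
    (s : ℝ) : Integrable (fun t => w t * stepKernel s t) ∧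
      ∫ t, w t * stepKernel s t = ∫ t in (0 : ℝ)..s, w t := by
  have e : (fun t => w t * stepKernel s t) =
      fun t => (Ico 0 s).indicator w t - (Ico s 0).indicator w t := by
    funext t
    rw [stepKernel_eq]
    simp only [indicator, Pi.one_apply]
    split_ifs <;> simp
  have hi : ∀ a b, IntegrableOn w (Ico a b) := by
    intro a b
    rw [integrableOn_Ico_iff_integrableOn_Ioo, ← integrableOn_Ioc_iff_integrableOn_Ioo]
    exact (hw a b).1
  have h1 := (integrable_indicator_iff measurableSet_Ico).2 (hi 0 s)
  have h2 := (integrable_indicator_iff measurableSet_Ico).2 (hi s 0)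
  rw [e]
  refine ⟨h1.sub h2, ?_⟩
  rw [integral_sub h1 h2, integral_indicator measurableSet_Ico,
    integral_indicator measurableSet_Ico, integral_Ico_eq_integral_Ioc,
    integral_Ico_eq_integral_Ioc]
  rfl

theorem integral_norm_stepKernel (s : ℝ) : ∫ t, ‖stepKernel s t‖ = |s| := by
  have e : (fun t => ‖stepKernel s t‖) =
      fun t => (if 0 ≤ s then 1 else -1) * stepKernel s t := by
    funext t
    unfold stepKernel
    split_ifs <;> simp <;> linarith
  rw [e, (integral_mul_stepKernel (fun a b => intervalIntegrable_const) s).2]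
  simp only [intervalIntegral.integral_const, sub_zero, smul_eq_mul]
  split_ifs with h
  · rw [abs_of_nonneg h]; ring
  · rw [abs_of_neg (not_le.1 h)]; ring

theorem integrable_stepKernel_prod (Q : Measure ℝ) [IsProbabilityMeasure Q]
    (hQ : Integrable (fun x => x) Q) :
    Integrable (Function.uncurry stepKernel) (Q.prod volume) := by
  rw [integrable_prod_iff measurable_stepKernel.aestronglyMeasurable]
  refine ⟨ae_of_all _ fun s => ?_, ?_⟩
  · have := (integral_mul_stepKernel (w := fun _ => 1)
      (fun a b => intervalIntegrable_const) s).1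
    simpa [Function.uncurry] using this
  · simp only [Function.uncurry, integral_norm_stepKernel]
    exact hQ.abs

theorem integral_stepKernel_left (Q : Measure ℝ) [IsProbabilityMeasure Q] (t : ℝ) :
    ∫ s, stepKernel s t ∂Q = (if 0 ≤ t then 1 else 0) - Q.real (Iic t) := by
  have e : (fun s => stepKernel s t) =
      fun s => (if 0 ≤ t then (1 : ℝ) else 0) - (Iic t).indicator 1 s := by
    funext s
    simp [stepKernel, indicator]
  rw [e, integral_sub (integrable_const _)
    ((integrable_indicator_iff measurableSet_Iic).2 (integrable_const _).integrableOn)]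
  simp [integral_indicator_one measurableSet_Iic]

theorem integral_primitive (Q : Measure ℝ) [IsProbabilityMeasure Q]
    (hQ : Integrable (fun x => x) Q) {w : ℝ → ℝ} (hw : Measurable w) {n : ℝ}
    (hn : ∀ t, |w t| ≤ n) :
    Integrable (fun t => w t * ((if 0 ≤ t then 1 else 0) - Q.real (Iic t))) ∧
    ∫ s, (∫ t in (0 : ℝ)..s, w t) ∂Q =
      ∫ t, w t * ((if 0 ≤ t then 1 else 0) - Q.real (Iic t)) := by
  have hI : Integrable (fun p : ℝ × ℝ => w p.2 * stepKernel p.1 p.2) (Q.prod volume) :=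
    (integrable_stepKernel_prod Q hQ).bdd_mul (c := n)
      (hw.comp measurable_snd).aestronglyMeasurable (ae_of_all _ fun p => hn p.2)
  have hwi : ∀ a b, IntervalIntegrable w volume a b := fun a b =>
    (intervalIntegrable_const (c := n)).mono_fun hw.aestronglyMeasurable
      (ae_of_all _ fun t => (hn t).trans (le_abs_self n))
  have e : ∀ t, ∫ s, w t * stepKernel s t ∂Q =
      w t * ((if 0 ≤ t then 1 else 0) - Q.real (Iic t)) := fun t => by
    rw [integral_const_mul, integral_stepKernel_left]
  constructor
  · simpa only [e] using hI.integral_prod_right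
  · simp only [← e]
    rw [← integral_integral_swap hI]
    refine integral_congr_ae (ae_of_all _ fun s => ?_)
    exact (integral_mul_stepKernel hwi s).2.symm

/-- Difference of expectations of a primitive, through the distribution functions. -/
theorem integral_primitive_sub (P Q : Measure ℝ) [IsProbabilityMeasure P]
    [IsProbabilityMeasure Q] (hP : Integrable (fun x => x) P) (hQ : Integrable (fun x => x) Q)
    {w : ℝ → ℝ} (hw : Measurable w) {n : ℝ} (hn : ∀ t, |w t| ≤ n) :
    Integrable (fun t => w t * (Q.real (Iic t) - P.real (Iic t))) ∧
    ∫ s, (∫ t in (0 : ℝ)..s, w t) ∂P - ∫ s, (∫ t in (0 : ℝ)..s, w t) ∂Q =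
      ∫ t, w t * (Q.real (Iic t) - P.real (Iic t)) := by
  obtain ⟨h1, h2⟩ := integral_primitive P hP hw hn
  obtain ⟨h3, h4⟩ := integral_primitive Q hQ hw hn
  have e : (fun t => w t * (Q.real (Iic t) - P.real (Iic t))) = fun t =>
    w t * ((if 0 ≤ t then 1 else 0) - P.real (Iic t)) -
      w t * ((if 0 ≤ t then 1 else 0) - Q.real (Iic t)) := by funext t; ring
  rw [e]
  exact ⟨h1.sub h3, by rw [integral_sub h1 h3, h2, h4]⟩

theorem integral_mul_eq_layers {w H : ℝ → ℝ} (hw : Measurable w) {n : ℝ}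
    (hn : ∀ t, |w t| ≤ n) (hH : Integrable H) (hH0 : ∫ t, H t = 0) :
    Integrable (fun v => ∫ t in {t | v < w t}, H t) (volume.restrict (Ioc (-n) n)) ∧
    ∫ t, w t * H t = ∫ v in Ioc (-n) n, ∫ t in {t | v < w t}, H t := by
  have hlayer : ∀ t, ∫ v in Ioc (-n) n, (if v < w t then (1 : ℝ) else 0) = w t + n := by
    intro t
    have h1 := abs_le.1 (hn t)
    have e : (fun v => if v < w t then (1 : ℝ) else 0) = (Iio (w t)).indicator 1 := by
      funext v; simp [indicator]
    rw [e, setIntegral_indicator measurableSet_Iio]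
    simp only [Pi.one_apply, integral_const, MeasurableSet.univ, measureReal_restrict_apply,
      univ_inter, smul_eq_mul, mul_one]
    have : Ioc (-n) n ∩ Iio (w t) = Ioo (-n) (w t) := by
      ext v; simp only [mem_inter_iff, mem_Ioc, mem_Iio, mem_Ioo]
      constructor
      · rintro ⟨⟨a, b⟩, c⟩; exact ⟨a, c⟩
      · rintro ⟨a, b⟩; exact ⟨⟨a, by linarith⟩, b⟩
    rw [this, Real.volume_real_Ioo_of_le h1.1]
    ring
  have hmeas : Measurable fun p : ℝ × ℝ => if p.2 < w p.1 then (1 : ℝ) else 0 :=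
    Measurable.ite (measurableSet_lt measurable_snd (hw.comp measurable_fst)) measurable_const
      measurable_const
  have hI : Integrable (fun p : ℝ × ℝ => (if p.2 < w p.1 then (1 : ℝ) else 0) * H p.1)
      (volume.prod (volume.restrict (Ioc (-n) n))) := by
    refine Integrable.bdd_mul (c := 1) ?_ hmeas.aestronglyMeasurable
      (ae_of_all _ fun p => by split_ifs <;> simp)
    exact hH.comp_fst _
  have hJ : ∀ v, ∫ t, (if v < w t then (1 : ℝ) else 0) * H t = ∫ t in {t | v < w t}, H t := by
    intro v
    rw [← integral_indicator (measurableSet_lt measurable_const hw)]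
    congr 1; funext t; simp [indicator]
  constructor
  · simpa only [hJ] using hI.integral_prod_right
  · simp only [← hJ]
    rw [← integral_integral_swap hI]
    have : ∀ t, ∫ v in Ioc (-n) n, (if v < w t then (1 : ℝ) else 0) * H t =
        w t * H t + n * H t := by
      intro t
      rw [integral_mul_const, hlayer]; ring
    simp only [this]
    rw [integral_add, integral_const_mul, hH0]
    · simp
    · exact hH.bdd_mul (c := n) hw.aestronglyMeasurable (ae_of_all _ hn)
    · exact hH.const_mul n

/-- Superlevel sets of an antitone function are, up to null sets, half-lines. -/
theorem exists_superlevel_eq_Iic {w : ℝ → ℝ} (hw : Antitone w) (H : ℝ → ℝ) {v a b : ℝ}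
    (ha : v < w a) (hb : w b ≤ v) :
    ∃ y ∈ Icc a b, (∀ t < y, v < w t) ∧ (∀ t > y, w t ≤ v) ∧
      ∫ t in {t | v < w t}, H t = ∫ t in Iic y, H t := by
  have hub : b ∈ upperBounds {t | v < w t} := fun t ht => by
    by_contra hc
    exact absurd (hw (not_le.1 hc).le) (not_le.2 (hb.trans_lt ht))
  have hne : {t | v < w t}.Nonempty := ⟨a, ha⟩
  have hbdd : BddAbove {t | v < w t} := ⟨b, hub⟩
  have h1 : ∀ t < sSup {t | v < w t}, v < w t := by
    intro t ht
    obtain ⟨u, hu, htu⟩ := exists_lt_of_lt_csSup hne ht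
    exact lt_of_lt_of_le hu (hw htu.le)
  have h2 : ∀ t > sSup {t | v < w t}, w t ≤ v := by
    intro t ht
    by_contra hc
    exact absurd (le_csSup hbdd (not_le.1 hc : t ∈ {t | v < w t})) (not_le.2 ht)
  refine ⟨_, ⟨le_csSup hbdd ha, csSup_le hne hub⟩, h1, h2, setIntegral_congr_set ?_⟩
  have hne' : ∀ᵐ t : ℝ, t ≠ sSup {t | v < w t} := by
    simp [ae_iff, measure_singleton]
  filter_upwards [hne'] with t ht
  exact propext ⟨fun h => le_csSup hbdd h, fun h => h1 t (lt_of_le_of_ne h ht)⟩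

theorem setIntegral_superlevel {w H : ℝ → ℝ} (hw : Antitone w) (v : ℝ) :
    ∫ t in {t | v < w t}, H t = 0 ∨ ∫ t in {t | v < w t}, H t = ∫ t, H t ∨
    ∃ y, (∀ t < y, v < w t) ∧ (∀ t > y, w t ≤ v) ∧
      ∫ t in {t | v < w t}, H t = ∫ t in Iic y, H t := by
  by_cases ha : ∃ a, v < w a
  · obtain ⟨a, ha⟩ := ha
    by_cases hb : ∃ b, w b ≤ v
    · obtain ⟨b, hb⟩ := hb
      obtain ⟨y, -, hy⟩ := exists_superlevel_eq_Iic hw H ha hb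
      exact Or.inr (Or.inr ⟨y, hy⟩)
    · push Not at hb
      simp [hb]
  · push Not at ha
    simp [not_lt.2 (ha _)]

theorem IsDensity.integrable {f : ℝ → ℝ} (hf : IsDensity f) : Integrable f := by
  refine ⟨hf.2.1.aestronglyMeasurable, ?_⟩
  rw [hasFiniteIntegral_iff_ofReal (ae_of_all _ hf.1), hf.2.2]
  exact ENNReal.one_lt_top

theorem IsDensity.integral_eq_one {f : ℝ → ℝ} (hf : IsDensity f) : ∫ x, f x = 1 := by
  rw [integral_eq_lintegral_of_nonneg_ae (ae_of_all _ hf.1) hf.2.1.aestronglyMeasurable, hf.2.2]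
  simp

theorem IsDensity.exists_pos {f : ℝ → ℝ} (hf : IsDensity f) : ∃ x, 0 < f x := by
  by_contra! h
  have h0 : f = 0 := funext fun x => le_antisymm (h x) (hf.1 x)
  have := hf.integral_eq_one
  simp [h0] at this

theorem isLogConcaveFn_iff_log {f : ℝ → ℝ} : IsLogConcaveFn f ↔
    (∀ x, 0 ≤ f x) ∧ ∀ x y, 0 < f x → 0 < f y → ∀ a b : ℝ, 0 ≤ a → 0 ≤ b → a + b = 1 →
      0 < f (a * x + b * y) ∧
      a * Real.log (f x) + b * Real.log (f y) ≤ Real.log (f (a * x + b * y)) := by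
  constructor
  · rintro ⟨h0, h⟩
    refine ⟨h0, fun x y hx hy a b ha hb hab => ?_⟩
    have := h x y b ⟨hb, by linarith⟩
    have ea : 1 - b = a := by linarith
    rw [ea] at this
    simp only [smul_eq_mul] at this
    have hpos : 0 < f x ^ a * f y ^ b := by positivity
    refine ⟨hpos.trans_le this, ?_⟩
    have := Real.log_le_log hpos this
    rwa [Real.log_mul (by positivity) (by positivity), Real.log_rpow hx, Real.log_rpow hy] at this
  · rintro ⟨h0, h⟩
    refine ⟨h0, fun x y t ht => ?_⟩
    simp only [smul_eq_mul]
    rcases eq_or_lt_of_le ht.1 with h1 | h1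
    · simp [← h1]
    rcases eq_or_lt_of_le ht.2 with h2 | h2
    · simp [h2]
    rcases eq_or_lt_of_le (h0 x) with hx | hx
    · rw [← hx, Real.zero_rpow (by linarith), zero_mul]; exact h0 _
    rcases eq_or_lt_of_le (h0 y) with hy | hy
    · rw [← hy, Real.zero_rpow (by linarith), mul_zero]; exact h0 _
    obtain ⟨hp, hl⟩ := h x y hx hy (1 - t) t (by linarith) ht.1 (by ring)
    rw [← Real.log_le_log_iff (by positivity) hp, Real.log_mul (by positivity) (by positivity),
      Real.log_rpow hx, Real.log_rpow hy]
    exact hl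

theorem IsLogConcaveFn.comp_neg {f : ℝ → ℝ} (hf : IsLogConcaveFn f) :
    IsLogConcaveFn fun x => f (-x) := by
  refine ⟨fun x => hf.1 _, fun x y t ht => ?_⟩
  have := hf.2 (-x) (-y) t ht
  convert this using 2
  simp only [smul_eq_mul]; ring

theorem IsLogConcaveFn.exp_tail_right {f : ℝ → ℝ} (hf : IsLogConcaveFn f) (hi : Integrable f)
    (hp : ∃ x, 0 < f x) :
    ∃ C a R : ℝ, 0 < C ∧ 0 < a ∧ ∀ y, R ≤ y → f y ≤ C * Real.exp (-(a * y)) := by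
  obtain ⟨x₀, hx₀⟩ := hp
  obtain ⟨M, hM, hMf⟩ : ∃ M > x₀, f M < f x₀ := by
    by_contra! h
    have h1 : Integrable (fun _ : ℝ => f x₀) (volume.restrict (Ioi x₀)) := by
      refine hi.integrableOn.mono' aestronglyMeasurable_const ?_
      filter_upwards [ae_restrict_mem measurableSet_Ioi] with y hy
      rw [Real.norm_of_nonneg hx₀.le]; exact h y hy
    rw [integrable_const_iff] at h1
    rcases h1 with h1 | h1
    · exact hx₀.ne' h1
    · have := h1.measure_univ_lt_top
      simp at this
  rw [isLogConcaveFn_iff_log] at hf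
  obtain ⟨h0, hl⟩ := hf
  rcases eq_or_lt_of_le (h0 M) with hM0 | hM0
  · refine ⟨1, 1, M, one_pos, one_pos, fun y hy => ?_⟩
    have : f y = 0 := by
      by_contra hy0
      have hyp : 0 < f y := lt_of_le_of_ne (h0 y) (Ne.symm hy0)
      have hd : 0 < y - x₀ := by linarith
      have := (hl x₀ y hx₀ hyp ((y - M) / (y - x₀)) ((M - x₀) / (y - x₀))
        (div_nonneg (by linarith) hd.le) (div_nonneg (by linarith) hd.le) (by field_simp; ring)).1
      have e : (y - M) / (y - x₀) * x₀ + (M - x₀) / (y - x₀) * y = M := by field_simp; ring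
      rw [e, ← hM0] at this
      exact lt_irrefl _ this
    rw [this]; positivity
  · have hlog : Real.log (f M) < Real.log (f x₀) := Real.log_lt_log hM0 hMf
    set a := (Real.log (f x₀) - Real.log (f M)) / (M - x₀) with ha
    have hMx : 0 < M - x₀ := by linarith
    have hapos : 0 < a := div_pos (by linarith) hMx
    refine ⟨Real.exp (Real.log (f x₀) + a * x₀), a, M, Real.exp_pos _, hapos, fun y hy => ?_⟩
    rcases eq_or_lt_of_le (h0 y) with hy0 | hy0
    · rw [← hy0]; positivity
    rw [← Real.exp_add, ← Real.log_le_iff_le_exp hy0]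
    have hd : 0 < y - x₀ := by linarith
    have := (hl x₀ y hx₀ hy0 ((y - M) / (y - x₀)) ((M - x₀) / (y - x₀))
        (div_nonneg (by linarith) hd.le) (div_nonneg (by linarith) hd.le) (by field_simp; ring)).2
    have e : (y - M) / (y - x₀) * x₀ + (M - x₀) / (y - x₀) * y = M := by field_simp; ring
    rw [e] at this
    have e2 : Real.log (f M) = Real.log (f x₀) - a * (M - x₀) := by rw [ha]; field_simp; ring
    rw [e2] at this
    have h3 := mul_le_mul_of_nonneg_right this hd.le
    have e3 : ((y - M) / (y - x₀) * Real.log (f x₀) + (M - x₀) / (y - x₀) * Real.log (f y)) *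
      (y - x₀) = (y - M) * Real.log (f x₀) + (M - x₀) * Real.log (f y) := by field_simp
    rw [e3] at h3
    have h4 : (M - x₀) * Real.log (f y) ≤
      (M - x₀) * (Real.log (f x₀) + a * x₀ + -(a * y)) := by nlinarith
    exact le_of_mul_le_mul_left h4 hMx

/-- Log-concave densities have exponentially decaying tails. -/
theorem IsLCDensity.exp_tail {f : ℝ → ℝ} (hf : IsLCDensity f) :
    ∃ C a : ℝ, 0 < C ∧ 0 < a ∧ a ≤ 1 ∧ ∀ y, f y ≤ C * Real.exp (-(a * |y|)) := by
  obtain ⟨hd, husc, hlc⟩ := hf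
  obtain ⟨x₀, hx₀⟩ := hd.exists_pos
  obtain ⟨C₁, a₁, R₁, hC₁, ha₁, h₁⟩ := hlc.exp_tail_right hd.integrable ⟨x₀, hx₀⟩
  obtain ⟨C₂, a₂, R₂, hC₂, ha₂, h₂⟩ := hlc.comp_neg.exp_tail_right hd.integrable.comp_neg
    ⟨-x₀, by simpa using hx₀⟩
  set R := max 0 (max R₁ R₂)
  have hR1 : R₁ ≤ R := (le_max_left _ _).trans (le_max_right _ _)
  have hR2 : R₂ ≤ R := (le_max_right _ _).trans (le_max_right _ _)
  have hR0 : 0 ≤ R := le_max_left _ _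
  obtain ⟨B, hB⟩ := UpperSemicontinuousOn.bddAbove_of_isCompact (isCompact_Icc (a := -R) (b := R))
    (husc.upperSemicontinuousOn _)
  set a := min 1 (min a₁ a₂)
  have ha0 : 0 < a := lt_min one_pos (lt_min ha₁ ha₂)
  have haa1 : a ≤ a₁ := (min_le_right _ _).trans (min_le_left _ _)
  have haa2 : a ≤ a₂ := (min_le_right _ _).trans (min_le_right _ _)
  refine ⟨C₁ + C₂ + |B| * Real.exp (a * R), a, by positivity, ha0, min_le_left _ _,
    fun y => ?_⟩
  have hBn : 0 ≤ |B| * Real.exp (a * R) := by positivity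
  have hE : 0 < Real.exp (-(a * |y|)) := Real.exp_pos _
  by_cases hy : |y| ≤ R
  · have h3 : f y ≤ |B| := (hB ⟨y, abs_le.1 hy, rfl⟩).trans (le_abs_self B)
    have h4 : 1 ≤ Real.exp (a * R) * Real.exp (-(a * |y|)) := by
      rw [← Real.exp_add]
      exact Real.one_le_exp (by nlinarith)
    calc f y ≤ |B| * 1 := by linarith
      _ ≤ |B| * (Real.exp (a * R) * Real.exp (-(a * |y|))) := by gcongr
      _ ≤ _ := by nlinarith [mul_pos hC₁ hE, mul_pos hC₂ hE]
  · push Not at hy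
    rcases le_total 0 y with h | h
    · rw [abs_of_nonneg h] at hy hE ⊢
      calc f y ≤ C₁ * Real.exp (-(a₁ * y)) := h₁ y (by linarith)
        _ ≤ C₁ * Real.exp (-(a * y)) := by gcongr
        _ ≤ _ := by gcongr; linarith
    · rw [abs_of_nonpos h] at hy hE ⊢
      calc f y ≤ C₂ * Real.exp (-(a₂ * -y)) := by simpa using h₂ (-y) (by linarith)
        _ ≤ C₂ * Real.exp (-(a * -y)) := by
            gcongr; linarith
        _ ≤ _ := by gcongr; linarith

theorem upperSemicontinuous_mul_exp {f g : ℝ → ℝ} (hf : UpperSemicontinuous f)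
    (hg : Continuous g) : UpperSemicontinuous fun s => f s * Real.exp (g s) := by
  intro u y hy
  have hu : f u < y * Real.exp (-g u) := by
    have := mul_lt_mul_of_pos_right hy (Real.exp_pos (-g u))
    rwa [mul_assoc, ← Real.exp_add, add_neg_cancel, Real.exp_zero, mul_one] at this
  obtain ⟨z, hz1, hz2⟩ := exists_between hu
  have hcont : ContinuousAt (fun u => y * Real.exp (-g u)) u := by fun_prop
  filter_upwards [hf u z hz1, hcont.eventually_const_lt hz2] with v hv1 hv2
  have := mul_lt_mul_of_pos_right (hv1.trans hv2) (Real.exp_pos (g v))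
  rwa [mul_assoc y, ← Real.exp_add, neg_add_cancel, Real.exp_zero, mul_one] at this

/-- The `κ`-Lipschitz (in log-scale) sup-convolution of `f`. -/
def supConv (f : ℝ → ℝ) (κ s : ℝ) : ℝ := ⨆ t, f t * Real.exp (-(κ * |s - t|))

section supConv

variable {f : ℝ → ℝ} (hf : IsLCDensity f) {κ : ℝ} (hκ : 0 < κ)

include hf hκ

theorem supConv_spec (s : ℝ) :
    (∃ t, supConv f κ s = f t * Real.exp (-(κ * |s - t|))) ∧
      ∀ u, f u * Real.exp (-(κ * |s - u|)) ≤ supConv f κ s := by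
  obtain ⟨C, a, hC, ha, -, hT⟩ := hf.exp_tail
  obtain ⟨⟨h0, -, -⟩, husc, hlc⟩ := id hf
  obtain ⟨x₀, hx₀⟩ := hf.1.exists_pos
  set h : ℝ → ℝ := fun u => f u * Real.exp (-(κ * |s - u|)) with hh
  have hx : 0 < h x₀ := by positivity
  have hlim : Tendsto (fun y : ℝ => C * Real.exp (-(a * y))) atTop (𝓝 0) := by
    have : Tendsto (fun y : ℝ => -(a * y)) atTop atBot :=
      tendsto_neg_atTop_atBot.comp (tendsto_id.const_mul_atTop ha)
    simpa using (Real.tendsto_exp_atBot.comp this).const_mul C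
  obtain ⟨R, hR⟩ := ((hlim.eventually_lt_const hx).and (eventually_ge_atTop |x₀|)).exists
  have hfar : ∀ u, R ≤ |u| → h u ≤ h x₀ := by
    intro u hu
    calc h u ≤ f u * 1 := by
          refine mul_le_mul_of_nonneg_left (Real.exp_le_one_iff.2 ?_) (h0 u)
          have := abs_nonneg (s - u)
          nlinarith
      _ ≤ C * Real.exp (-(a * |u|)) := by linarith [hT u]
      _ ≤ C * Real.exp (-(a * R)) := by gcongr
      _ ≤ h x₀ := hR.1.le
  have husc' : UpperSemicontinuous h := upperSemicontinuous_mul_exp husc (by fun_prop)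
  obtain ⟨t, -, ht⟩ := UpperSemicontinuousOn.exists_isMaxOn (s := Icc (-R) R)
    ⟨x₀, abs_le.1 hR.2⟩ isCompact_Icc (husc'.upperSemicontinuousOn _)
  have hmax : ∀ u, h u ≤ h t := by
    intro u
    rcases le_total |u| R with hu | hu
    · exact ht (abs_le.1 hu)
    · exact (hfar u hu).trans (ht (abs_le.1 hR.2))
  have hbdd : BddAbove (range h) := ⟨h t, by rintro _ ⟨u, rfl⟩; exact hmax u⟩
  exact ⟨⟨t, le_antisymm (ciSup_le hmax) (le_ciSup hbdd t)⟩, fun u => le_ciSup hbdd u⟩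

theorem le_supConv (s : ℝ) : f s ≤ supConv f κ s := by
  simpa using (supConv_spec hf hκ s).2 s

theorem supConv_pos (s : ℝ) : 0 < supConv f κ s := by
  obtain ⟨x₀, hx₀⟩ := hf.1.exists_pos
  exact lt_of_lt_of_le (by positivity) ((supConv_spec hf hκ s).2 x₀)

/-- The logarithmic form of `supConv_spec`. -/
theorem log_supConv_spec (s : ℝ) :
    (∃ t, 0 < f t ∧ Real.log (supConv f κ s) = Real.log (f t) - κ * |s - t|) ∧
      ∀ u, 0 < f u → Real.log (f u) - κ * |s - u| ≤ Real.log (supConv f κ s) := by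
  obtain ⟨⟨t, ht⟩, h⟩ := supConv_spec hf hκ s
  have hlog : ∀ u, 0 < f u → Real.log (f u * Real.exp (-(κ * |s - u|))) =
      Real.log (f u) - κ * |s - u| := fun u hu => by
    rw [Real.log_mul hu.ne' (Real.exp_pos _).ne', Real.log_exp]; ring
  have htp : 0 < f t := by
    have := supConv_pos hf hκ s
    rw [ht] at this
    exact pos_of_mul_pos_left this (Real.exp_pos _).le
  refine ⟨⟨t, htp, by rw [ht, hlog t htp]⟩, fun u hu => ?_⟩
  rw [← hlog u hu]
  exact Real.log_le_log (by positivity) (h u)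

theorem log_supConv_lipschitz (s u : ℝ) :
    Real.log (supConv f κ u) - κ * |s - u| ≤ Real.log (supConv f κ s) := by
  obtain ⟨t, ht, he⟩ := (log_supConv_spec hf hκ u).1
  have := (log_supConv_spec hf hκ s).2 t ht
  have h3 := abs_sub_le s u t
  rw [he]
  nlinarith

theorem continuous_log_supConv : Continuous fun s => Real.log (supConv f κ s) := by
  refine LipschitzWith.continuous (K := Real.toNNReal κ)
    (LipschitzWith.of_dist_le_mul fun s u => ?_)
  have h1 := log_supConv_lipschitz hf hκ s u
  have h2 := log_supConv_lipschitz hf hκ u s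
  rw [abs_sub_comm] at h2
  rw [Real.dist_eq, Real.dist_eq, abs_le]
  rw [Real.coe_toNNReal κ hκ.le]
  constructor <;> linarith

theorem continuous_supConv : Continuous (supConv f κ) := by
  have : supConv f κ = fun s => Real.exp (Real.log (supConv f κ s)) := by
    funext s; rw [Real.exp_log (supConv_pos hf hκ s)]
  rw [this]
  exact Real.continuous_exp.comp (continuous_log_supConv hf hκ)

theorem abs_log_supConv_le (s : ℝ) :
    |Real.log (supConv f κ s)| ≤ |Real.log (supConv f κ 0)| + κ * |s| := by
  have h1 := log_supConv_lipschitz hf hκ s 0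
  have h2 := log_supConv_lipschitz hf hκ 0 s
  rw [zero_sub, abs_neg] at h2
  rw [sub_zero] at h1
  have := abs_le.1 (le_refl |Real.log (supConv f κ 0)|)
  rw [abs_le]
  constructor <;> linarith

theorem concaveOn_log_supConv : ConcaveOn ℝ univ fun s => Real.log (supConv f κ s) := by
  refine ⟨convex_univ, fun s _ u _ a b ha hb hab => ?_⟩
  simp only [smul_eq_mul]
  obtain ⟨t, ht, het⟩ := (log_supConv_spec hf hκ s).1
  obtain ⟨r, hr, her⟩ := (log_supConv_spec hf hκ u).1
  obtain ⟨hp, hl⟩ := (isLogConcaveFn_iff_log.1 hf.2.2).2 t r ht hr a b ha hb hab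
  have := (log_supConv_spec hf hκ (a * s + b * u)).2 _ hp
  have h3 : |a * s + b * u - (a * t + b * r)| ≤ a * |s - t| + b * |u - r| := by
    have e : a * s + b * u - (a * t + b * r) = a * (s - t) + b * (u - r) := by ring
    rw [e]
    refine (abs_add_le _ _).trans ?_
    rw [abs_mul, abs_mul, abs_of_nonneg ha, abs_of_nonneg hb]
  rw [het, her]
  nlinarith

theorem supConv_le {C a : ℝ} (haκ : a ≤ κ) (ha : 0 < a)
    (hC : ∀ y, f y ≤ C * Real.exp (-(a * |y|))) (s : ℝ) :
    supConv f κ s ≤ C * Real.exp (-(a * |s|)) := by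
  obtain ⟨⟨t, ht⟩, -⟩ := supConv_spec hf hκ s
  have hC0 : 0 ≤ C := by
    have := (hf.1.1 0).trans (hC 0)
    simpa using this
  rw [ht]
  calc f t * Real.exp (-(κ * |s - t|)) ≤
        C * Real.exp (-(a * |t|)) * Real.exp (-(κ * |s - t|)) := by gcongr; exact hC t
    _ = C * Real.exp (-(a * |t|) + -(κ * |s - t|)) := by rw [mul_assoc, ← Real.exp_add]
    _ ≤ C * Real.exp (-(a * |s|)) := by
      gcongr
      have h1 : |s| ≤ |s - t| + |t| := by
        simpa using abs_sub_le s t 0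
      nlinarith [abs_nonneg (s - t)]

theorem supConv_anti {κ' : ℝ} (h : κ ≤ κ') (s : ℝ) : supConv f κ' s ≤ supConv f κ s := by
  obtain ⟨⟨t, ht⟩, -⟩ := supConv_spec hf (hκ.trans_le h) s
  rw [ht]
  refine le_trans ?_ ((supConv_spec hf hκ s).2 t)
  have := hf.1.1 t
  gcongr

/-- Dividing a log-concave function by its sup-convolution preserves log-concavity. -/
theorem isLogConcaveFn_div_supConv :
    IsLogConcaveFn fun s => f s * Real.exp (-Real.log (supConv f κ s)) := by
  rw [isLogConcaveFn_iff_log]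
  refine ⟨fun x => mul_nonneg (hf.1.1 x) (Real.exp_pos _).le, ?_⟩
  have hlog : ∀ s, 0 < f s → Real.log (f s * Real.exp (-Real.log (supConv f κ s))) =
      Real.log (f s) - Real.log (supConv f κ s) := fun s hs => by
    rw [Real.log_mul hs.ne' (Real.exp_pos _).ne', Real.log_exp]; ring
  have hlc := (isLogConcaveFn_iff_log.1 hf.2.2).2
  intro s u hs hu a b ha hb hab
  replace hs : 0 < f s := pos_of_mul_pos_left hs (Real.exp_pos _).le
  replace hu : 0 < f u := pos_of_mul_pos_left hu (Real.exp_pos _).le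
  obtain ⟨hm, hml⟩ := hlc s u hs hu a b ha hb hab
  refine ⟨by positivity, ?_⟩
  rw [hlog s hs, hlog u hu, hlog _ hm]
  wlog hsu : s ≤ u generalizing s u a b
  · have := this u s b a hb ha (by linarith) hu hs (by rwa [add_comm])
      (by rw [add_comm (b * u), add_comm (b * _)]; exact hml) (le_of_not_ge hsu)
    rw [add_comm (b * u)] at this
    linarith
  set m := a * s + b * u with hmdef
  obtain ⟨c, hc, hec⟩ := (log_supConv_spec hf hκ m).1
  have hLs := (log_supConv_spec hf hκ s).2
  have hLu := (log_supConv_spec hf hκ u).2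
  have hρs : Real.log (f s) ≤ Real.log (supConv f κ s) := by simpa using hLs s hs
  have hρu : Real.log (f u) ≤ Real.log (supConv f κ u) := by simpa using hLu u hu
  have ha' : a = 1 - b := by linarith
  have outside : |m - c| = a * |s - c| + b * |u - c| →
      a * (Real.log (f s) - Real.log (supConv f κ s)) +
        b * (Real.log (f u) - Real.log (supConv f κ u)) ≤
      Real.log (f m) - Real.log (supConv f κ m) := by
    intro h
    have h1 := mul_le_mul_of_nonneg_left (hLs c hc) ha
    have h2 := mul_le_mul_of_nonneg_left (hLu c hc) hb
    have h3 : (a + b) * Real.log (f c) = Real.log (f c) := by rw [hab, one_mul]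
    rw [hec, h]
    linarith
  have inside : ∀ q r : ℝ, 0 < f r → 0 ≤ q → q ≤ 1 → m = (1 - q) * c + q * r →
      Real.log (supConv f κ m) - Real.log (f m) ≤
        q * (Real.log (supConv f κ r) - Real.log (f r)) := by
    intro q r hr hq hq1 hmr
    have h1 := (hlc c r hc hr (1 - q) q (by linarith) hq (by ring)).2
    rw [← hmr] at h1
    have h2 := mul_le_mul_of_nonneg_left ((log_supConv_spec hf hκ r).2 c hc) hq
    have h3 : |m - c| = q * |r - c| := by
      have : m - c = q * (r - c) := by rw [hmr]; ring
      rw [this, abs_mul, abs_of_nonneg hq]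
    rw [hec, h3]
    linarith
  have ms : m - s = b * (u - s) := by rw [hmdef, ha']; ring
  have mu : u - m = a * (u - s) := by rw [hmdef, ha']; ring
  have hms : s ≤ m := by nlinarith
  have hmu : m ≤ u := by nlinarith
  rcases le_or_gt c s with hcs | hcs
  · apply outside
    rw [abs_of_nonneg (by linarith), abs_of_nonneg (by linarith), abs_of_nonneg (by linarith),
      hmdef, ha']
    ring
  rcases le_or_gt u c with hcu | hcu
  · apply outside
    rw [abs_of_nonpos (by linarith), abs_of_nonpos (by linarith), abs_of_nonpos (by linarith),
      hmdef, ha']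
    ring
  rcases le_total c m with hcm | hcm
  · have hd : 0 < u - c := by linarith
    have hq : (m - c) / (u - c) ≤ b := by
      rw [div_le_iff₀ hd]; nlinarith
    have := inside ((m - c) / (u - c)) u hu (div_nonneg (by linarith) hd.le)
      ((div_le_one hd).2 (by linarith)) (by field_simp; ring)
    have h2 := mul_le_mul_of_nonneg_right hq (sub_nonneg.2 hρu)
    have h3 := mul_le_mul_of_nonneg_left hρs ha
    linarith
  · have hd : 0 < c - s := by linarith
    have hq : (c - m) / (c - s) ≤ a := by
      rw [div_le_iff₀ hd]; nlinarith
    have := inside ((c - m) / (c - s)) s hs (div_nonneg (by linarith) hd.le)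
      ((div_le_one hd).2 (by linarith)) (by field_simp; ring)
    have h2 := mul_le_mul_of_nonneg_right hq (sub_nonneg.2 hρs)
    have h3 := mul_le_mul_of_nonneg_left hρu hb
    linarith

/-- Kinks of the sup-convolution are kinks of the function itself. -/
theorem kink_of_supConv_kink {y : ℝ}
    (hy : ∀ δ > 0, Real.log (supConv f κ (y + δ)) + Real.log (supConv f κ (y - δ)) <
      2 * Real.log (supConv f κ y)) :
    0 < f y ∧ ∀ δ > 0, f (y + δ) * f (y - δ) < f y ^ 2 := by
  obtain ⟨t, ht, he⟩ := (log_supConv_spec hf hκ y).1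
  have hty : t = y := by
    by_contra hne
    rcases lt_or_gt_of_ne hne with h | h
    · have h0 := hy (y - t) (by linarith)
      have h1 := (log_supConv_spec hf hκ (y + (y - t))).2 t ht
      have h2 := (log_supConv_spec hf hκ (y - (y - t))).2 t ht
      rw [abs_of_pos (by linarith)] at he h1
      rw [sub_sub_cancel, sub_self, abs_zero] at h2
      rw [sub_sub_cancel] at h0
      linarith
    · have h0 := hy (t - y) (by linarith)
      have h1 := (log_supConv_spec hf hκ (y + (t - y))).2 t ht
      have h2 := (log_supConv_spec hf hκ (y - (t - y))).2 t ht
      rw [abs_of_neg (by linarith)] at he h2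
      rw [add_sub_cancel, sub_self, abs_zero] at h1
      rw [add_sub_cancel] at h0
      linarith
  subst hty
  refine ⟨ht, fun δ hδ => ?_⟩
  have h0 := hy δ hδ
  rw [he, sub_self, abs_zero, mul_zero, sub_zero] at h0
  rcases eq_or_lt_of_le (hf.1.1 (t + δ)) with h1 | h1
  · rw [← h1, zero_mul]; positivity
  rcases eq_or_lt_of_le (hf.1.1 (t - δ)) with h2 | h2
  · rw [← h2, mul_zero]; positivity
  rw [← Real.log_lt_log_iff (by positivity) (by positivity), Real.log_mul h1.ne' h2.ne',
    Real.log_pow]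
  have h3 := (log_supConv_spec hf hκ (t + δ)).2 _ h1
  have h4 := (log_supConv_spec hf hκ (t - δ)).2 _ h2
  rw [sub_self, abs_zero, mul_zero, sub_zero] at h3 h4
  push_cast
  linarith
end supConv

theorem tendsto_supConv {f : ℝ → ℝ} (hf : IsLCDensity f) (s : ℝ) :
    Tendsto (fun n : ℕ => supConv f ((n : ℝ) + 1) s) atTop (𝓝 (f s)) := by
  have hn : ∀ n : ℕ, (0 : ℝ) < n + 1 := fun n => by positivity
  obtain ⟨C, a, hC, ha, -, hT⟩ := hf.exp_tail
  have hM : ∀ y, f y ≤ C := fun y => (hT y).trans <| by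
    have : Real.exp (-(a * |y|)) ≤ 1 := Real.exp_le_one_iff.2 (by
      have := abs_nonneg y
      nlinarith)
    nlinarith
  rw [tendsto_order]
  refine ⟨fun y hy => Eventually.of_forall fun n => hy.trans_le (le_supConv hf (hn n) s),
    fun y hy => ?_⟩
  have hy0 : 0 < y := (hf.1.1 s).trans_lt hy
  obtain ⟨r, hr, hball⟩ := Metric.eventually_nhds_iff.1 (hf.2.1 s y hy)
  have hlim : Tendsto (fun n : ℕ => C * Real.exp (-(((n : ℝ) + 1) * r))) atTop (𝓝 0) := by
    have : Tendsto (fun n : ℕ => -(((n : ℝ) + 1) * r)) atTop atBot :=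
      tendsto_neg_atTop_atBot.comp
        ((tendsto_atTop_add_const_right _ _ tendsto_natCast_atTop_atTop).atTop_mul_const hr)
    simpa using (Real.tendsto_exp_atBot.comp this).const_mul C
  filter_upwards [hlim.eventually_lt_const hy0] with n hlt
  obtain ⟨⟨t, ht⟩, -⟩ := supConv_spec hf (hn n) s
  rw [ht]
  have h0 := hf.1.1 t
  rcases lt_or_ge (dist t s) r with h | h
  · refine lt_of_le_of_lt ?_ (hball h)
    refine mul_le_of_le_one_right h0 (Real.exp_le_one_iff.2 ?_)
    have := abs_nonneg (s - t)
    have := hn n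
    nlinarith
  · refine lt_of_le_of_lt ?_ hlt
    rw [Real.dist_eq, abs_sub_comm] at h
    have := hn n
    gcongr
    exact hM t

/-- A kink of `f` is detected, at every scale `δ`, by some sup-convolution. -/
theorem exists_supConv_kink {f : ℝ → ℝ} (hf : IsLCDensity f) {x δ : ℝ}
    (h : f (x + δ) * f (x - δ) < f x ^ 2) :
    ∃ n : ℕ, Real.log (supConv f ((n : ℝ) + 1) (x + δ)) +
      Real.log (supConv f ((n : ℝ) + 1) (x - δ)) < 2 * Real.log (supConv f ((n : ℝ) + 1) x) := by
  have h1 := (tendsto_supConv hf (x + δ)).mul (tendsto_supConv hf (x - δ))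
  have h2 := (tendsto_supConv hf x).pow 2
  obtain ⟨n, hn⟩ := (h1.eventually_lt h2 h).exists
  refine ⟨n, ?_⟩
  have hp : ∀ y, 0 < supConv f ((n : ℝ) + 1) y := supConv_pos hf (by positivity)
  have := Real.log_lt_log (mul_pos (hp _) (hp _)) hn
  rw [Real.log_mul (hp _).ne' (hp _).ne', Real.log_pow] at this
  exact_mod_cast this

/-- The strict midpoint inequality for `log f` in multiplicative form. -/
theorem elog_midpoint_iff {a b c : ℝ} (ha : 0 ≤ a) (hb : 0 ≤ b) (hc : 0 < c) :
    elog a + elog b < (2 : EReal) * elog c ↔ a * b < c ^ 2 := by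
  have h2 : (2 : EReal) * elog c = ((2 * Real.log c : ℝ) : EReal) := by
    rw [elog, if_neg (not_le.2 hc)]; push_cast; rfl
  rw [h2]
  have h0 : elog 0 = ⊥ := by simp [elog]
  rcases eq_or_lt_of_le ha with h | ha
  · rw [← h, h0, EReal.bot_add, zero_mul]
    exact iff_of_true (EReal.bot_lt_coe _) (by positivity)
  rcases eq_or_lt_of_le hb with h | hb
  · rw [← h, h0, EReal.add_bot, mul_zero]
    exact iff_of_true (EReal.bot_lt_coe _) (by positivity)
  rw [elog, elog, if_neg (not_le.2 ha), if_neg (not_le.2 hb), ← EReal.coe_add, EReal.coe_lt_coe_iff,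
    ← Real.log_lt_log_iff (mul_pos ha hb) (pow_pos hc 2), Real.log_mul ha.ne' hb.ne',
    Real.log_pow]
  norm_num

open ProbabilityTheory

theorem integrable_exp_neg_mul_abs {a : ℝ} (ha : 0 < a) :
    Integrable fun s : ℝ => Real.exp (-(a * |s|)) := by
  have h : IntegrableOn (fun s : ℝ => Real.exp (-(a * |s|))) (Ioi 0) := by
    refine (exp_neg_integrableOn_Ioi 0 ha).congr_fun (fun s hs => ?_) measurableSet_Ioi
    simp only [abs_of_pos (mem_Ioi.1 hs), neg_mul]
  have h' : IntegrableOn (fun s : ℝ => Real.exp (-(a * |s|))) (Iic 0) := by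
    have := h.comp_neg
    simp only [abs_neg, neg_Ioi, neg_zero] at this
    exact (integrableOn_Iic_iff_integrableOn_Iio (by simp)).2 this
  rw [← integrableOn_univ, ← Iic_union_Ioi (a := (0 : ℝ))]
  exact h'.union h

/-- The probability measure on `ℝ` with Lebesgue density `f`. -/
def densityMeasure (f : ℝ → ℝ) : Measure ℝ :=
  volume.withDensity fun x => ENNReal.ofReal (f x)

section densityMeasure

variable {f : ℝ → ℝ} (hf : IsDensity f)

include hf

theorem isProbabilityMeasure_densityMeasure : IsProbabilityMeasure (densityMeasure f) := by
  refine ⟨?_⟩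
  rw [densityMeasure, withDensity_apply _ MeasurableSet.univ, Measure.restrict_univ, hf.2.2]

theorem integrable_densityMeasure_iff {g : ℝ → ℝ} :
    Integrable g (densityMeasure f) ↔ Integrable fun x => f x * g x := by
  rw [densityMeasure, integrable_withDensity_iff_integrable_smul' hf.2.1.ennreal_ofReal
    (ae_of_all _ fun x => ENNReal.ofReal_lt_top)]
  simp only [ENNReal.toReal_ofReal (hf.1 _), smul_eq_mul]

theorem integral_densityMeasure (g : ℝ → ℝ) :
    ∫ x, g x ∂densityMeasure f = ∫ x, f x * g x := by
  rw [densityMeasure, integral_withDensity_eq_integral_toReal_smul hf.2.1.ennreal_ofReal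
    (ae_of_all _ fun x => ENNReal.ofReal_lt_top)]
  simp only [ENNReal.toReal_ofReal (hf.1 _), smul_eq_mul]

theorem densityMeasure_real (s : Set ℝ) (hs : MeasurableSet s) :
    (densityMeasure f).real s = ∫ x in s, f x := by
  rw [Measure.real, densityMeasure, withDensity_apply _ hs,
    integral_eq_lintegral_of_nonneg_ae (ae_of_all _ hf.1) hf.2.1.aestronglyMeasurable]

end densityMeasure

theorem IsLCDensity.zero_mem_interior_integrableExpSet {f Δ : ℝ → ℝ} (hf : IsLCDensity f)
    (hm : Measurable Δ) {A B : ℝ} (hB : 0 ≤ B) (hΔ : ∀ s, |Δ s| ≤ A + B * |s|) :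
    0 ∈ interior (integrableExpSet Δ (densityMeasure f)) := by
  obtain ⟨C, a, hC, ha, -, hT⟩ := hf.exp_tail
  have hr : 0 < a / (2 * (B + 1)) := by positivity
  rw [mem_interior_iff_mem_nhds]
  filter_upwards [Ioo_mem_nhds (neg_lt_zero.2 hr) hr] with t ht
  have hta : |t| ≤ a / (2 * (B + 1)) := (abs_lt.2 ht).le
  have htB : |t| * B ≤ a / 2 := by
    rw [le_div_iff₀ (by positivity)] at hta
    nlinarith [abs_nonneg t]
  show Integrable _ _
  rw [integrable_densityMeasure_iff hf.1]
  refine ((integrable_exp_neg_mul_abs (half_pos ha)).const_mul (C * Real.exp (|t| * A))).mono'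
    ((hf.1.2.1.mul ((hm.const_mul t).exp)).aestronglyMeasurable) (ae_of_all _ fun s => ?_)
  rw [Real.norm_of_nonneg (mul_nonneg (hf.1.1 s) (Real.exp_pos _).le)]
  calc f s * Real.exp (t * Δ s)
      ≤ (C * Real.exp (-(a * |s|))) * Real.exp (|t| * (A + B * |s|)) := by
        refine mul_le_mul (hT s) (Real.exp_le_exp.2 ?_) (Real.exp_pos _).le (by positivity)
        refine (le_abs_self _).trans ((abs_mul _ _).trans_le ?_)
        gcongr
        exact hΔ s
    _ = C * Real.exp (-(a * |s|) + |t| * (A + B * |s|)) := by rw [mul_assoc, ← Real.exp_add]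
    _ ≤ C * Real.exp (|t| * A + -(a / 2 * |s|)) := by
        refine mul_le_mul_of_nonneg_left (Real.exp_le_exp.2 ?_) hC.le
        nlinarith [mul_le_mul_of_nonneg_right htB (abs_nonneg s)]
    _ = _ := by rw [Real.exp_add, mul_assoc]

theorem IsLCDensity.integrable_of_growth {f Δ : ℝ → ℝ} (hf : IsLCDensity f)
    (hm : Measurable Δ) {A B : ℝ} (hB : 0 ≤ B) (hΔ : ∀ s, |Δ s| ≤ A + B * |s|) :
    Integrable Δ (densityMeasure f) :=
  integrable_of_mem_interior_integrableExpSet (hf.zero_mem_interior_integrableExpSet hm hB hΔ)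

/-- Multiplicative perturbations of a log-concave density `f` which stay log-concave. -/
theorem IsLogConcaveFn.mul_exp_interpolate {f Δ : ℝ → ℝ} (hf : IsLogConcaveFn f)
    (hlc : IsLogConcaveFn fun s => f s * Real.exp (Δ s)) {ε c : ℝ} (h0 : 0 ≤ ε) (h1 : ε ≤ 1) :
    IsLogConcaveFn fun s => f s * Real.exp (ε * Δ s - c) := by
  rw [isLogConcaveFn_iff_log] at hf hlc ⊢
  have hlog : ∀ (g : ℝ → ℝ) s, 0 < f s → Real.log (f s * Real.exp (g s)) =
      Real.log (f s) + g s := fun g s hs => by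
    rw [Real.log_mul hs.ne' (Real.exp_pos _).ne', Real.log_exp]
  refine ⟨fun s => mul_nonneg (hf.1 s) (Real.exp_pos _).le, fun x y hx hy a b ha hb hab => ?_⟩
  have hx' := pos_of_mul_pos_left hx (Real.exp_pos _).le
  have hy' := pos_of_mul_pos_left hy (Real.exp_pos _).le
  obtain ⟨hp, hl⟩ := hf.2 x y hx' hy' a b ha hb hab
  have hl' := (hlc.2 x y (by positivity) (by positivity) a b ha hb hab).2
  refine ⟨by positivity, ?_⟩
  rw [hlog Δ _ hx', hlog Δ _ hy', hlog Δ _ hp] at hl'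
  rw [hlog (fun s => ε * Δ s - c) _ hx', hlog (fun s => ε * Δ s - c) _ hy',
    hlog (fun s => ε * Δ s - c) _ hp]
  have hc : a * c + b * c = c := by rw [← add_mul, hab, one_mul]
  nlinarith [mul_le_mul_of_nonneg_left hl' h0, mul_le_mul_of_nonneg_left hl (sub_nonneg.2 h1)]

/-- First variation of the log-likelihood at its maximiser. -/
theorem IsLCProj.integral_le {P : Measure ℝ} [IsProbabilityMeasure P]
    (hP : Integrable (fun x => x) P) {f Δ : ℝ → ℝ} (hf : IsLCProj P f) (hc : Continuous Δ)
    {A B : ℝ} (hB : 0 ≤ B) (hΔ : ∀ s, |Δ s| ≤ A + B * |s|)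
    (hlc : IsLogConcaveFn fun s => f s * Real.exp (Δ s)) :
    ∫ s, Δ s ∂P ≤ ∫ s, Δ s ∂densityMeasure f := by
  obtain ⟨hd, hpos, hint, hmax⟩ := hf
  have := isProbabilityMeasure_densityMeasure hd.1
  have hI := hd.zero_mem_interior_integrableExpSet hc.measurable hB hΔ
  have hΔP : Integrable Δ P := by
    refine ((integrable_const A).add (hP.abs.const_mul B)).mono' hc.aestronglyMeasurable
      (ae_of_all _ hΔ)
  have key : ∀ᶠ ε in 𝓝[>] (0 : ℝ), ∫ s, Δ s ∂P ≤ ε⁻¹ * cgf Δ (densityMeasure f) ε := by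
    filter_upwards [Ioo_mem_nhdsGT one_pos,
      nhdsWithin_le_nhds (mem_interior_iff_mem_nhds.1 hI)] with ε hε hεI
    have hεI' : Integrable (fun s => Real.exp (ε * Δ s)) (densityMeasure f) := hεI
    set c := cgf Δ (densityMeasure f) ε with hcdef
    have hexp : Real.exp c = mgf Δ (densityMeasure f) ε := exp_cgf hεI'
    set g : ℝ → ℝ := fun s => f s * Real.exp (ε * Δ s - c) with hg
    have hg0 : ∀ s, 0 ≤ g s := fun s => mul_nonneg (hd.1.1 s) (Real.exp_pos _).le
    have hgm : Measurable g := hd.1.2.1.mul ((hc.measurable.const_mul ε).sub_const c).exp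
    have hge : g = fun s => Real.exp (-c) * (f s * Real.exp (ε * Δ s)) := by
      funext s
      rw [hg]; simp only
      rw [sub_eq_add_neg, Real.exp_add]; ring
    have hgd : IsLCDensity g := by
      refine ⟨⟨hg0, hgm, ?_⟩, upperSemicontinuous_mul_exp hd.2.1 (by fun_prop),
        hd.2.2.mul_exp_interpolate hlc hε.1.le hε.2.le⟩
      have hgi : Integrable g := by
        rw [hge]
        exact ((integrable_densityMeasure_iff hd.1).1 hεI').const_mul _
      rw [← ofReal_integral_eq_lintegral_ofReal hgi (ae_of_all _ hg0), hge, integral_const_mul,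
        ← integral_densityMeasure hd.1]
      rw [mgf] at hexp
      rw [← hexp, ← Real.exp_add]; simp
    have hlogg : (fun s => Real.log (g s)) =ᵐ[P] fun s => Real.log (f s) + (ε * Δ s - c) := by
      filter_upwards [hpos] with s hs
      rw [hg]; simp only
      rw [Real.log_mul hs.ne' (Real.exp_pos _).ne', Real.log_exp]
    have hi2 : Integrable (fun s => ε * Δ s - c) P := (hΔP.const_mul ε).sub (integrable_const c)
    have := hmax g hgd (hpos.mono fun s hs => mul_pos hs (Real.exp_pos _))
      ((hint.add hi2).congr hlogg.symm)
    rw [integral_congr_ae hlogg, integral_add hint hi2,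
      integral_sub (hΔP.const_mul ε) (integrable_const c), integral_const_mul] at this
    simp only [integral_const, probReal_univ, smul_eq_mul, one_mul] at this
    rw [inv_mul_eq_div, le_div_iff₀ hε.1]
    linarith
  have hderiv : HasDerivAt (cgf Δ (densityMeasure f)) (∫ s, Δ s ∂densityMeasure f) 0 := by
    have h := deriv_cgf_zero hI
    rw [probReal_univ, div_one] at h
    rw [← h]
    exact (analyticAt_cgf hI).differentiableAt.hasDerivAt
  have hlim := hderiv.tendsto_slope_zero_right
  simp only [zero_add, cgf_zero, sub_zero, smul_eq_mul] at hlim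
  exact ge_of_tendsto hlim key

theorem IsLogConcaveFn.mul_exp_of_concaveOn {f Δ : ℝ → ℝ} (hf : IsLogConcaveFn f)
    (hΔ : ConcaveOn ℝ univ Δ) : IsLogConcaveFn fun s => f s * Real.exp (Δ s) := by
  rw [isLogConcaveFn_iff_log] at hf ⊢
  refine ⟨fun s => mul_nonneg (hf.1 s) (Real.exp_pos _).le, fun x y hx hy a b ha hb hab => ?_⟩
  have hx' := pos_of_mul_pos_left hx (Real.exp_pos _).le
  have hy' := pos_of_mul_pos_left hy (Real.exp_pos _).le
  obtain ⟨hp, hl⟩ := hf.2 x y hx' hy' a b ha hb hab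
  have hc := hΔ.2 (mem_univ x) (mem_univ y) ha hb hab
  simp only [smul_eq_mul] at hc
  refine ⟨by positivity, ?_⟩
  rw [Real.log_mul hx'.ne' (Real.exp_pos _).ne', Real.log_mul hy'.ne' (Real.exp_pos _).ne',
    Real.log_mul hp.ne' (Real.exp_pos _).ne', Real.log_exp, Real.log_exp, Real.log_exp]
  linarith

/-- The difference between the distribution function with density `f` and that of `P`. -/
def cdfGap (P : Measure ℝ) (f : ℝ → ℝ) (t : ℝ) : ℝ :=
  (∫ s in Iic t, f s) - (P (Iic t)).toReal

section cdfGap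

variable {P : Measure ℝ} [IsProbabilityMeasure P] (hP : Integrable (fun x => x) P)
  {f : ℝ → ℝ} (hf : IsLCDensity f)

include hf in
theorem IsLCDensity.integrable_id : Integrable (fun x => x) (densityMeasure f) :=
  hf.integrable_of_growth measurable_id (A := 0) zero_le_one fun s => by simp

include hP hf

theorem integral_mul_cdfGap {w : ℝ → ℝ} (hw : Measurable w) {n : ℝ} (hn : ∀ t, |w t| ≤ n) :
    Integrable (fun t => w t * cdfGap P f t) ∧
    ∫ s, (∫ t in (0 : ℝ)..s, w t) ∂P - ∫ s, (∫ t in (0 : ℝ)..s, w t) ∂densityMeasure f =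
      ∫ t, w t * cdfGap P f t := by
  have := isProbabilityMeasure_densityMeasure hf.1
  have h := integral_primitive_sub P (densityMeasure f) hP hf.integrable_id hw hn
  simp only [densityMeasure_real hf.1 _ measurableSet_Iic] at h
  exact h

theorem integrable_cdfGap : Integrable (cdfGap P f) := by
  simpa using (integral_mul_cdfGap hP hf (w := fun _ => 1) measurable_const (n := 1)
    (fun t => by simp)).1

theorem integral_cdfGap :
    ∫ t, cdfGap P f t = ∫ s, s ∂P - ∫ s, s ∂densityMeasure f := by
  simpa using (integral_mul_cdfGap hP hf (w := fun _ => 1) measurable_const (n := 1)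
    (fun t => by simp)).2.symm

theorem setIntegral_cdfGap_Iic (x : ℝ) :
    ∫ t in Iic x, cdfGap P f t =
      ∫ s, (min s x - min 0 x) ∂P - ∫ s, (min s x - min 0 x) ∂densityMeasure f := by
  have h1 : ∀ s, ∫ t in x..s, (Iic x).indicator (1 : ℝ → ℝ) t = min s x - x := by
    intro s
    rcases le_total s x with h | h
    · rw [min_eq_left h, intervalIntegral.integral_congr (g := fun _ => 1)]
      · simp
      · intro t ht
        rw [uIcc_of_ge h] at ht
        simp [ht.2]
    · rw [min_eq_right h, sub_self]
      refine intervalIntegral.integral_zero_ae (ae_of_all _ fun t ht => ?_)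
      rw [uIoc_of_le h] at ht
      simp [ht.1]
  have hi : ∀ a b, IntervalIntegrable ((Iic x).indicator (1 : ℝ → ℝ)) volume a b := fun a b =>
    ⟨(integrable_const (1 : ℝ)).indicator measurableSet_Iic,
      (integrable_const (1 : ℝ)).indicator measurableSet_Iic⟩
  have h2 : ∀ s, ∫ t in (0 : ℝ)..s, (Iic x).indicator (1 : ℝ → ℝ) t = min s x - min 0 x := by
    intro s
    rw [← intervalIntegral.integral_interval_sub_left (hi x s) (hi x 0), h1, h1]
    ring
  have h := (integral_mul_cdfGap hP hf (w := (Iic x).indicator (1 : ℝ → ℝ))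
    (measurable_const.indicator measurableSet_Iic) (n := 1) (fun t => by
      unfold indicator; split_ifs <;> simp)).2
  simp only [h2] at h
  rw [h, ← integral_indicator measurableSet_Iic]
  congr 1
  funext t
  simp [indicator]

/-- Integrated differences of a concave Lipschitz function, expressed through the integrals of
`cdfGap` over the superlevel sets of a supergradient. -/
theorem integral_sub_eq_layers (h0 : ∫ t, cdfGap P f t = 0) {L : ℝ → ℝ} {κ : ℝ}
    (hL : ConcaveOn ℝ univ L) (hκ : ∀ s u, L u - κ * |s - u| ≤ L s)
    (hLP : Integrable L P) (hLf : Integrable L (densityMeasure f)) :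
    ∃ w : ℝ → ℝ, Antitone w ∧ (∀ s u, L u ≤ L s + w s * (u - s)) ∧ (∀ t, |w t| ≤ κ) ∧
      Integrable (fun v => ∫ t in {t | v < w t}, cdfGap P f t) (volume.restrict (Ioc (-κ) κ)) ∧
      ∫ s, L s ∂P - ∫ s, L s ∂densityMeasure f =
        ∫ v in Ioc (-κ) κ, ∫ t in {t | v < w t}, cdfGap P f t := by
  have := isProbabilityMeasure_densityMeasure hf.1
  obtain ⟨w, hw, hsup, hint⟩ := exists_supergradient hL
  have hwκ : ∀ t, |w t| ≤ κ := by
    intro t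
    have h1 := hκ (t + 1) t
    have h2 := hκ (t - 1) t
    have h3 := hsup t (t + 1)
    have h4 := hsup t (t - 1)
    simp only [add_sub_cancel_left, abs_one, sub_sub_cancel_left, abs_neg] at h1 h2 h3 h4
    exact abs_le.2 ⟨by linarith, by linarith⟩
  obtain ⟨h1, h2⟩ := integral_mul_eq_layers hw.measurable hwκ (integrable_cdfGap hP hf) h0
  refine ⟨w, hw, hsup, hwκ, h1, ?_⟩
  rw [← h2, ← (integral_mul_cdfGap hP hf hw.measurable hwκ).2]
  simp only [hint]
  rw [integral_sub hLP (integrable_const _), integral_sub hLf (integrable_const _)]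
  simp

end cdfGap

theorem midpoint_lt_of_supergradient {L w : ℝ → ℝ}
    (hsup : ∀ s u, L u ≤ L s + w s * (u - s)) {v y : ℝ} (h1 : ∀ t < y, v < w t)
    (h2 : ∀ t > y, w t ≤ v) {δ : ℝ} (hδ : 0 < δ) : L (y + δ) + L (y - δ) < 2 * L y := by
  have a1 := hsup (y - δ / 2) (y - δ)
  have a2 := hsup (y + δ / 2) (y + δ)
  have a3 := hsup y (y - δ / 2)
  have a4 := hsup y (y + δ / 2)
  have b1 := h1 (y - δ / 2) (by linarith)
  have b2 := h2 (y + δ / 2) (by linarith)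
  nlinarith

theorem supergradient_lt_of_midpoint_lt {L w : ℝ → ℝ}
    (hsup : ∀ s u, L u ≤ L s + w s * (u - s)) {x δ : ℝ} (hδ : 0 < δ)
    (h : L (x + δ) + L (x - δ) < 2 * L x) : w (x + δ) < w (x - δ) := by
  have a1 := hsup (x - δ) x
  have a2 := hsup (x + δ) x
  nlinarith

theorem setIntegral_superlevel_nonpos {w H : ℝ → ℝ} (hw : Antitone w) (h0 : ∫ t, H t = 0)
    (hH : ∀ x, ∫ t in Iic x, H t ≤ 0) (v : ℝ) : ∫ t in {t | v < w t}, H t ≤ 0 := by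
  rcases setIntegral_superlevel (H := H) hw v with h | h | ⟨y, -, -, h⟩
  · exact h.le
  · exact (h.trans h0).le
  · exact h.trans_le (hH y)

theorem continuous_setIntegral_Iic {H : ℝ → ℝ} (hH : Integrable H) :
    Continuous fun x => ∫ t in Iic x, H t := by
  have e : (fun x => ∫ t in Iic x, H t) =
      fun x => (∫ t in Iic (0 : ℝ), H t) + ∫ t in (0 : ℝ)..x, H t := by
    funext x
    rw [← intervalIntegral.integral_Iic_sub_Iic hH.integrableOn hH.integrableOn]
    ring
  rw [e]
  exact continuous_const.add
    (intervalIntegral.continuous_primitive (fun a b => hH.intervalIntegrable) 0)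

section

variable {P : Measure ℝ} [IsProbabilityMeasure P] (hP : Integrable (fun x => x) P)

include hP in
theorem integrable_log_supConv {f : ℝ → ℝ} (hf : IsLCDensity f) {κ : ℝ} (hκ : 0 < κ) :
    Integrable (fun s => Real.log (supConv f κ s)) P :=
  ((integrable_const _).add (hP.abs.const_mul κ)).mono'
    (continuous_log_supConv hf hκ).aestronglyMeasurable
    (ae_of_all _ (abs_log_supConv_le hf hκ))

theorem integrable_log_supConv_densityMeasure {f g : ℝ → ℝ} (hf : IsLCDensity f)
    (hg : IsLCDensity g) {κ : ℝ} (hκ : 0 < κ) :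
    Integrable (fun s => Real.log (supConv g κ s)) (densityMeasure f) :=
  hf.integrable_of_growth (continuous_log_supConv hg hκ).measurable hκ.le
    (abs_log_supConv_le hg hκ)

variable {f : ℝ → ℝ}

include hP

theorem IsLCProj.integral_cdfGap_eq_zero (hf : IsLCProj P f) : ∫ t, cdfGap P f t = 0 := by
  rw [integral_cdfGap hP hf.1]
  have h1 := hf.integral_le hP (Δ := fun s => s) continuous_id (A := 0) zero_le_one
    (fun s => by simp) (hf.1.2.2.mul_exp_of_concaveOn (concaveOn_id convex_univ))
  have h2 := hf.integral_le hP (Δ := fun s => -s) continuous_neg (A := 0) zero_le_one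
    (fun s => by simp) (hf.1.2.2.mul_exp_of_concaveOn (convexOn_id convex_univ).neg)
  rw [integral_neg, integral_neg] at h2
  linarith

theorem IsLCProj.setIntegral_cdfGap_nonpos (hf : IsLCProj P f) (x : ℝ) :
    ∫ t in Iic x, cdfGap P f t ≤ 0 := by
  rw [setIntegral_cdfGap_Iic hP hf.1, sub_nonpos]
  refine hf.integral_le hP (by fun_prop) (A := 0) zero_le_one (fun s => ?_)
    (hf.1.2.2.mul_exp_of_concaveOn ?_)
  · rw [zero_add, one_mul, abs_le]
    have := neg_abs_le s
    have := le_abs_self s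
    constructor <;> rcases le_total s x with h | h <;> rcases le_total 0 x with h' | h' <;>
      simp [h, h'] <;> linarith [abs_nonneg s]
  · exact ((concaveOn_id convex_univ).inf (concaveOn_const x convex_univ)).sub
      (convexOn_const (min 0 x) convex_univ)

theorem IsLCProj.setIntegral_cdfGap_eq_zero (hf : IsLCProj P f) {x : ℝ}
    (hx : ∀ δ > 0, f (x + δ) * f (x - δ) < f x ^ 2) : ∫ t in Iic x, cdfGap P f t = 0 := by
  have h0 := hf.integral_cdfGap_eq_zero hP
  have hd := hf.1
  have hclosed : IsClosed {y | ∫ t in Iic y, cdfGap P f t = 0} :=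
    isClosed_eq (continuous_setIntegral_Iic (integrable_cdfGap hP hd)) continuous_const
  refine hclosed.closure_subset (Metric.mem_closure_iff.2 fun ε hε => ?_)
  obtain ⟨n, hn⟩ := exists_supConv_kink hd (hx (ε / 2) (half_pos hε))
  have hκ : (0 : ℝ) < n + 1 := by positivity
  obtain ⟨w, hw, hsup, hwκ, hJi, hJ⟩ := integral_sub_eq_layers hP hd h0
    (concaveOn_log_supConv hd hκ) (log_supConv_lipschitz hd hκ)
    (integrable_log_supConv hP hd hκ) (integrable_log_supConv_densityMeasure hd hd hκ)
  have hle := hf.integral_le hP (Δ := fun s => -Real.log (supConv f (n + 1) s))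
    (continuous_log_supConv hd hκ).neg hκ.le
    (fun s => (abs_neg _).trans_le (abs_log_supConv_le hd hκ s))
    (isLogConcaveFn_div_supConv hd hκ)
  rw [integral_neg, integral_neg] at hle
  have hJn := setIntegral_superlevel_nonpos hw h0 (hf.setIntegral_cdfGap_nonpos hP)
  have hJ0 : ∫ v in Ioc (-(n + 1 : ℝ)) (n + 1), ∫ t in {t | v < w t}, cdfGap P f t = 0 :=
    le_antisymm (integral_nonpos hJn) (by linarith)
  rw [← neg_eq_zero, ← integral_neg, integral_eq_zero_iff_of_nonneg
    (fun v => neg_nonneg.2 (hJn v)) hJi.neg, EventuallyEq,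
    ae_restrict_iff' measurableSet_Ioc] at hJ0
  have hlt := supergradient_lt_of_midpoint_lt hsup (half_pos hε) hn
  obtain ⟨v, hv, hv0⟩ := (Measure.dense_of_ae hJ0).inter_open_nonempty _ isOpen_Ioo
    (nonempty_Ioo.2 hlt)
  have hvm : v ∈ Ioc (-(n + 1 : ℝ)) (n + 1) :=
    ⟨(abs_le.1 (hwκ _)).1.trans_lt hv.1, hv.2.le.trans (abs_le.1 (hwκ _)).2⟩
  obtain ⟨y, hy, -, -, he⟩ := exists_superlevel_eq_Iic hw (cdfGap P f) hv.2 hv.1.le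
  refine ⟨y, he.symm.trans (neg_eq_zero.1 (hv0 hvm)), ?_⟩
  rw [Real.dist_eq, abs_lt]
  constructor <;> linarith [hy.1, hy.2]

end

theorem integrable_supConv {f : ℝ → ℝ} (hf : IsLCDensity f) {κ : ℝ} (hκ : 1 ≤ κ) :
    Integrable (supConv f κ) := by
  have hκ0 := zero_lt_one.trans_le hκ
  obtain ⟨C, a, hC, ha, ha1, hT⟩ := hf.exp_tail
  refine ((integrable_exp_neg_mul_abs ha).const_mul C).mono'
    (continuous_supConv hf hκ0).aestronglyMeasurable (ae_of_all _ fun s => ?_)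
  rw [Real.norm_of_nonneg (supConv_pos hf hκ0 s).le]
  exact supConv_le hf hκ0 (ha1.trans hκ) ha hT s

theorem tendsto_integral_supConv {f : ℝ → ℝ} (hf : IsLCDensity f) :
    Tendsto (fun n : ℕ => ∫ s, supConv f ((n : ℝ) + 1) s) atTop (𝓝 1) := by
  suffices h : Tendsto (fun n : ℕ => ∫ s, supConv f ((n : ℝ) + 1) s) atTop (𝓝 (∫ s, f s)) by
    rwa [hf.1.integral_eq_one] at h
  have hκ : ∀ n : ℕ, (1 : ℝ) ≤ n + 1 := fun n => by simp
  obtain ⟨C, a, hC, ha, ha1, hT⟩ := hf.exp_tail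
  refine tendsto_integral_of_dominated_convergence _
    (fun n => (integrable_supConv hf (hκ n)).aestronglyMeasurable)
    ((integrable_exp_neg_mul_abs ha).const_mul C) (fun n => ae_of_all _ fun s => ?_)
    (ae_of_all _ fun s => tendsto_supConv hf s)
  have hκ0 := zero_lt_one.trans_le (hκ n)
  rw [Real.norm_of_nonneg (supConv_pos hf hκ0 s).le]
  exact supConv_le hf hκ0 (ha1.trans (hκ n)) ha hT s

/-- The pointwise form of Gibbs' inequality. -/
theorem mul_log_sub_mul_log_le {p q : ℝ} (hp : 0 ≤ p) (hq : 0 < q) :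
    p * Real.log q - p * Real.log p ≤ q - p := by
  rcases hp.eq_or_lt with rfl | hp
  · simpa using hq.le
  · have h := Real.log_le_sub_one_of_pos (div_pos hq hp)
    rw [Real.log_div hq.ne' hp.ne'] at h
    have := mul_le_mul_of_nonneg_left h hp.le
    rwa [mul_sub, mul_sub, mul_div_cancel₀ _ hp.ne', mul_one] at this

theorem IsLCDensity.integrable_log {f : ℝ → ℝ} (hf : IsLCDensity f) :
    Integrable (fun s => Real.log (f s)) (densityMeasure f) := by
  have hL := integrable_log_supConv_densityMeasure hf hf one_pos
  rw [integrable_densityMeasure_iff hf.1] at hL ⊢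
  have hd : Integrable fun s => f s * Real.log (supConv f 1 s) - f s * Real.log (f s) := by
    refine ((integrable_supConv hf le_rfl).sub hf.1.integrable).mono'
      (hL.aestronglyMeasurable.sub
        (hf.1.2.1.mul hf.1.2.1.log).aestronglyMeasurable) (ae_of_all _ fun s => ?_)
    rw [Real.norm_of_nonneg]
    · exact mul_log_sub_mul_log_le (hf.1.1 s) (supConv_pos hf one_pos s)
    · rcases (hf.1.1 s).eq_or_lt with h | h
      · simp [← h]
      · have := Real.log_le_log h (le_supConv hf one_pos s)
        nlinarith
  exact (hL.sub hd).congr (ae_of_all _ fun s => sub_sub_cancel _ _)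

theorem integral_log_supConv_sub_le {f g : ℝ → ℝ} (hf : IsLCDensity f) (hg : IsLCDensity g)
    {κ : ℝ} (hκ : 1 ≤ κ) :
    ∫ s, Real.log (supConv g κ s) ∂densityMeasure f - ∫ s, Real.log (f s) ∂densityMeasure f ≤
      (∫ s, supConv g κ s) - 1 := by
  have hκ0 := zero_lt_one.trans_le hκ
  have h1 := (integrable_densityMeasure_iff hf.1).1
    (integrable_log_supConv_densityMeasure hf hg hκ0)
  have h2 := (integrable_densityMeasure_iff hf.1).1 hf.integrable_log
  rw [integral_densityMeasure hf.1, integral_densityMeasure hf.1, ← integral_sub h1 h2,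
    ← hf.1.integral_eq_one, ← integral_sub (integrable_supConv hg hκ) hf.1.integrable]
  exact integral_mono (h1.sub h2) ((integrable_supConv hg hκ).sub hf.1.integrable)
    fun s => mul_log_sub_mul_log_le (hf.1.1 s) (supConv_pos hg hκ0 s)

section

variable {P : Measure ℝ} [IsProbabilityMeasure P] (hP : Integrable (fun x => x) P)
  {f : ℝ → ℝ} (hf : IsLCDensity f) (h0 : ∫ t, cdfGap P f t = 0)

include hP hf h0

theorem integral_log_supConv_le_of_cdfGap (hA : ∀ x, ∫ t in Iic x, cdfGap P f t ≤ 0)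
    {g : ℝ → ℝ} (hg : IsLCDensity g) {κ : ℝ} (hκ : 0 < κ) :
    ∫ s, Real.log (supConv g κ s) ∂P ≤ ∫ s, Real.log (supConv g κ s) ∂densityMeasure f := by
  obtain ⟨w, hw, -, -, -, hJ⟩ := integral_sub_eq_layers hP hf h0
    (concaveOn_log_supConv hg hκ) (log_supConv_lipschitz hg hκ)
    (integrable_log_supConv hP hg hκ) (integrable_log_supConv_densityMeasure hf hg hκ)
  have := integral_nonpos (μ := volume.restrict (Ioc (-κ) κ))
    (setIntegral_superlevel_nonpos hw h0 hA)
  linarith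

theorem integral_log_supConv_eq_of_cdfGap
    (hB : ∀ x, 0 < f x → (∀ δ > 0, f (x + δ) * f (x - δ) < f x ^ 2) →
      ∫ t in Iic x, cdfGap P f t = 0) {κ : ℝ} (hκ : 0 < κ) :
    ∫ s, Real.log (supConv f κ s) ∂P = ∫ s, Real.log (supConv f κ s) ∂densityMeasure f := by
  obtain ⟨w, hw, hsup, -, -, hJ⟩ := integral_sub_eq_layers hP hf h0
    (concaveOn_log_supConv hf hκ) (log_supConv_lipschitz hf hκ)
    (integrable_log_supConv hP hf hκ) (integrable_log_supConv_densityMeasure hf hf hκ)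
  have hz : ∀ v, ∫ t in {t | v < w t}, cdfGap P f t = 0 := by
    intro v
    rcases setIntegral_superlevel (H := cdfGap P f) hw v with h | h | ⟨y, h1, h2, h⟩
    · exact h
    · exact h.trans h0
    · obtain ⟨hy, hk⟩ := kink_of_supConv_kink hf hκ
        fun δ hδ => midpoint_lt_of_supergradient hsup h1 h2 hδ
      exact h.trans (hB y hy hk)
  simp only [hz, integral_zero] at hJ
  linarith

theorem isLCProj_of_cdfGap (hA : ∀ x, ∫ t in Iic x, cdfGap P f t ≤ 0)
    (hB : ∀ x, 0 < f x → (∀ δ > 0, f (x + δ) * f (x - δ) < f x ^ 2) →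
      ∫ t in Iic x, cdfGap P f t = 0) : IsLCProj P f := by
  set K := ∫ s, Real.log (f s) ∂densityMeasure f with hK
  set L : ℕ → ℝ → ℝ := fun n s => Real.log (supConv f ((n : ℝ) + 1) s) with hLdef
  have hκ : ∀ n : ℕ, (0 : ℝ) < n + 1 := fun n => by positivity
  have hκ1 : ∀ n : ℕ, (1 : ℝ) ≤ n + 1 := fun n => by simp
  have hLP : ∀ n, Integrable (L n) P := fun n => integrable_log_supConv hP hf (hκ n)
  have hLf : ∀ n, Integrable (L n) (densityMeasure f) := fun n =>
    integrable_log_supConv_densityMeasure hf hf (hκ n)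
  have hLeq : ∀ n, ∫ s, L n s ∂P = ∫ s, L n s ∂densityMeasure f := fun n =>
    integral_log_supConv_eq_of_cdfGap hP hf h0 hB (hκ n)
  have hanti : ∀ s, Antitone fun n => L n s := fun s m n hmn =>
    Real.log_le_log (supConv_pos hf (hκ n) s) (supConv_anti hf (hκ m) (by gcongr) s)
  have hposae : ∀ᵐ s ∂densityMeasure f, 0 < f s := by
    rw [densityMeasure, ae_withDensity_iff hf.1.2.1.ennreal_ofReal]
    exact ae_of_all _ fun s hs => ENNReal.ofReal_pos.1 (pos_iff_ne_zero.2 hs)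
  have hKL : ∀ n, K ≤ ∫ s, L n s ∂densityMeasure f := fun n =>
    integral_mono_ae hf.integrable_log (hLf n) (hposae.mono fun s hs =>
      Real.log_le_log hs (le_supConv hf (hκ n) s))
  set h : ℝ → ℝ≥0∞ := fun s => ⨆ n, ENNReal.ofReal (L 0 s - L n s) with hh
  have hmeas : ∀ n, Measurable fun s => ENNReal.ofReal (L 0 s - L n s) := fun n =>
    ((continuous_log_supConv hf (hκ 0)).sub
      (continuous_log_supConv hf (hκ n))).measurable.ennreal_ofReal
  have hint : ∫⁻ s, h s ∂P ≤ ENNReal.ofReal (∫ s, L 0 s ∂P - K) := by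
    rw [hh, lintegral_iSup hmeas fun m n hmn s =>
      ENNReal.ofReal_le_ofReal (sub_le_sub_left (hanti s hmn) _)]
    refine iSup_le fun n => ?_
    refine (ofReal_integral_eq_lintegral_ofReal ((hLP 0).sub (hLP n))
      (ae_of_all _ fun s => sub_nonneg.2 (hanti s n.zero_le))).symm.trans_le ?_
    refine ENNReal.ofReal_le_ofReal ((integral_sub (hLP 0) (hLP n)).trans_le ?_)
    rw [hLeq n]
    exact sub_le_sub_left (hKL n) _
  have hhm : Measurable h := Measurable.iSup hmeas
  have hfin : ∫⁻ s, h s ∂P ≠ ∞ := ne_top_of_le_ne_top ENNReal.ofReal_ne_top hint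
  have hlt := ae_lt_top hhm hfin
  have hbound : ∀ s, h s < ∞ → 0 < f s ∧ L 0 s - Real.log (f s) ≤ (h s).toReal := by
    intro s hs
    have h1 : ∀ n : ℕ, Real.exp (L 0 s - (h s).toReal) ≤ supConv f ((n : ℝ) + 1) s := by
      intro n
      rw [← Real.exp_log (supConv_pos hf (hκ n) s), Real.exp_le_exp]
      have := (ENNReal.ofReal_le_iff_le_toReal hs.ne).1
        (le_iSup (fun n => ENNReal.ofReal (L 0 s - L n s)) n)
      simp only [hLdef] at this ⊢
      linarith
    have h2 := ge_of_tendsto' (tendsto_supConv hf s) h1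
    have h3 := (Real.exp_pos _).trans_le h2
    have := (Real.le_log_iff_exp_le h3).2 h2
    exact ⟨h3, by linarith⟩
  have hpos : ∀ᵐ s ∂P, 0 < f s := hlt.mono fun s hs => (hbound s hs).1
  have hhi : Integrable (fun s => (h s).toReal) P :=
    integrable_toReal_of_lintegral_ne_top hhm.aemeasurable hfin
  have hdiff : Integrable (fun s => L 0 s - Real.log (f s)) P := by
    refine hhi.mono' ((hLP 0).aestronglyMeasurable.sub hf.1.2.1.log.aestronglyMeasurable)
      (hlt.mono fun s hs => ?_)
    rw [Real.norm_of_nonneg (sub_nonneg.2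
      (Real.log_le_log (hbound s hs).1 (le_supConv hf (hκ 0) s)))]
    exact (hbound s hs).2
  have hlog : Integrable (fun s => Real.log (f s)) P :=
    ((hLP 0).sub hdiff).congr (ae_of_all _ fun s => sub_sub_cancel _ _)
  have hKle : K ≤ ∫ s, Real.log (f s) ∂P := by
    have h1 : ∫ s, (L 0 s - Real.log (f s)) ∂P ≤ ∫ s, L 0 s ∂P - K := by
      refine (integral_mono_ae hdiff hhi (hlt.mono fun s hs => (hbound s hs).2)).trans ?_
      rw [integral_toReal hhm.aemeasurable hlt]
      refine ENNReal.toReal_le_of_le_ofReal ?_ hint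
      rw [hLeq 0]
      exact sub_nonneg.2 (hKL 0)
    rw [integral_sub (hLP 0) hlog] at h1
    linarith
  refine ⟨hf, hpos, hlog, fun g hg hgpos hglog => ?_⟩
  have hlim := ((tendsto_integral_supConv hg).sub_const 1).const_add K
  rw [sub_self, add_zero] at hlim
  refine (ge_of_tendsto' hlim fun n => ?_).trans hKle
  have h1 : ∫ s, Real.log (g s) ∂P ≤ ∫ s, Real.log (supConv g ((n : ℝ) + 1) s) ∂P :=
    integral_mono_ae hglog (integrable_log_supConv hP hg (hκ n)) (hgpos.mono fun s hs =>
      Real.log_le_log hs (le_supConv hg (hκ n) s))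
  have h2 := integral_log_supConv_le_of_cdfGap hP hf h0 hA hg (hκ n)
  have h3 := integral_log_supConv_sub_le hf hg (hκ1 n)
  linarith

end

/-- Characterisation of the one-dimensional log-concave projection via integrated
distribution functions: `f* = ψ*(P)` iff `∫_{-∞}^x (F* - F) ≤ 0` for all `x`, with
equality at points where `log f*` is not locally affine, and equality in the limit
`x → ∞`. -/
theorem statement11 (P : Measure ℝ) (hP : MemP P)
    (fs : ℝ → ℝ) (hfs : IsLCDensity fs) :
    IsLCProj P fs ↔
      ((∀ x : ℝ,
          (∫ t in Set.Iic x, ((∫ s in Set.Iic t, fs s) - (P (Set.Iic t)).toReal)) ≤ 0) ∧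
       (∀ x : ℝ,
          (0 < fs x ∧ ∀ δ : ℝ, 0 < δ →
            elog (fs (x + δ)) + elog (fs (x - δ)) < (2 : EReal) * elog (fs x)) →
          (∫ t in Set.Iic x, ((∫ s in Set.Iic t, fs s) - (P (Set.Iic t)).toReal)) = 0) ∧
       (∫ t : ℝ, ((∫ s in Set.Iic t, fs s) - (P (Set.Iic t)).toReal)) = 0) := by
  have := hP.1
  have hP1 : Integrable (fun x => x) P := (integrable_norm_iff aestronglyMeasurable_id).1 hP.2.1
  constructor
  · intro h
    refine ⟨h.setIntegral_cdfGap_nonpos hP1, fun x hx => ?_, h.integral_cdfGap_eq_zero hP1⟩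
    exact h.setIntegral_cdfGap_eq_zero hP1 fun δ hδ =>
      (elog_midpoint_iff (hfs.1.1 _) (hfs.1.1 _) hx.1).1 (hx.2 δ hδ)
  · rintro ⟨hA, hB, h0⟩
    exact isLCProj_of_cdfGap hP1 hfs h0 hA fun x hx hk => hB x ⟨hx, fun δ hδ =>
      (elog_midpoint_iff (hfs.1.1 _) (hfs.1.1 _) hx).2 (hk δ hδ)⟩
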